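/- Let λ ≥ 0 and suppose L̄'_r(λ⁺) > -∞ and L̄'_r(λ⁺) is a limit point of the set {L̄'_r(t) : t > λ}. Then for every net (x_α, y_α) in [-∞,+∞]² (indexed by the same directed set A) such that (x_α) converges to L̄'_r(λ⁺) and liminf_α y_α > L̄'_r(λ⁺), one has limsup_α c_α·log μ_α([x_α, y_α]) = limsup_α c_α·log μ_α((x_α, y_α)) = L̄(λ⁺) − λ·L̄'_r(λ⁺) = −L̄*(L̄'_r(λ⁺)) = inf_{t>0} ( L̄(t) − t·L̄'_r(λ⁺) ). -/

import Mathlib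

open Filter MeasureTheory Set Topology

noncomputable section

/-- `c · log m` as an extended real number, where `m ∈ [0,∞]`. -/
def elog (c : ℝ) (m : ENNReal) : EReal := (c : EReal) * ENNReal.log m

/-- The generalized log-moment generating function `L̄` associated with the net
`(μ_α, c_α)` indexed by the filter `lf`:
`L̄(t) = limsup_α c_α · log ∫ exp(t·x/c_α) dμ_α(x)`. -/
def genLogMGF {ι : Type*} (lf : Filter ι) (μ : ι → Measure ℝ) (c : ι → ℝ) (t : ℝ) : EReal :=
  Filter.limsup
    (fun i => elog (c i) (∫⁻ x : ℝ, ENNReal.ofReal (Real.exp (t * x / c i)) ∂ (μ i))) lf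

/-- Legendre–Fenchel transform of an `EReal`-valued function on `ℝ`, evaluated at an
extended real argument: `L*(x) = sup_t (t·x − L(t))`. -/
def LegendreEE (L : ℝ → EReal) (x : EReal) : EReal := ⨆ t : ℝ, ((t : EReal) * x - L t)

open Classical in
/-- The right derivative of a convex `EReal`-valued function at `t`, with the conventions
`L'_r(t) = +∞` when `L(s) = +∞` for all `s > t` and `L'_r(t) = -∞` when `L(s) = -∞` for
some `s > t`; otherwise it is the infimum of the right difference quotients. -/
def rightDerivE (L : ℝ → EReal) (t : ℝ) : EReal :=
  if ∀ s : ℝ, t < s → L s = ⊤ then ⊤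
  else if ∃ s : ℝ, t < s ∧ L s = ⊥ then ⊥
  else ⨅ s ∈ Set.Ioi t, (L s - L t) * (((s - t)⁻¹ : ℝ) : EReal)

/-- The left derivative of a convex `EReal`-valued function at `t` (supremum of left
difference quotients). -/
def leftDerivE (L : ℝ → EReal) (t : ℝ) : EReal :=
  ⨆ s ∈ Set.Iio t, (L t - L s) * (((t - s)⁻¹ : ℝ) : EReal)

/-- Right limit at `a` of an `EReal`-valued function (as a `limsup`; it coincides with
`lim_{t→a⁺} f(t)` whenever the latter exists, e.g. for monotone or convex `f`). -/
def rightLimE (f : ℝ → EReal) (a : ℝ) : EReal := Filter.limsup f (nhdsWithin a (Set.Ioi a))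

/-- Left limit at `a` of an `EReal`-valued function (as a `limsup`; it coincides with
`lim_{t→a⁻} f(t)` whenever the latter exists). -/
def leftLimE (f : ℝ → EReal) (a : ℝ) : EReal := Filter.limsup f (nhdsWithin a (Set.Iio a))

/-- `L` is affine on the interval `(a, b]`. -/
def AffineOnIoc (L : ℝ → EReal) (a b : ℝ) : Prop :=
  ∃ p q : ℝ, ∀ s ∈ Set.Ioc a b, L s = ((p * s + q : ℝ) : EReal)

/-- `λ̃ = sup {t > λ : L is affine on (λ, t]}` (equal to `λ` if there is no such `t`). -/
def tildeOf (L : ℝ → EReal) (lam : ℝ) : ℝ :=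
  sSup (insert lam {t : ℝ | lam < t ∧ AffineOnIoc L lam t})

/-- Differentiability at `t` of an `EReal`-valued function: `L(t)` is finite and the
difference quotients converge to a (finite) real number. -/
def EDifferentiableAt (L : ℝ → EReal) (t : ℝ) : Prop :=
  (∃ r : ℝ, L t = (r : EReal)) ∧
  ∃ d : ℝ, Filter.Tendsto (fun s => (L s - L t) * (((s - t)⁻¹ : ℝ) : EReal))
    (nhdsWithin t {t}ᶜ) (nhds (d : EReal))

/-- The function `l₀(x) = − lim_{ε→0⁺} limsup_α c_α · log μ_α((x−ε, x+ε))` (the limit over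
`ε` exists by monotonicity and equals the infimum). -/
def l0fun {ι : Type*} (lf : Filter ι) (μ : ι → Measure ℝ) (c : ι → ℝ) (x : ℝ) : EReal :=
  - ⨅ ε ∈ Set.Ioi (0:ℝ),
      Filter.limsup (fun i => elog (c i) (μ i (Set.Ioo (x - ε) (x + ε)))) lf

/-- `L` restricted to `[0,∞)` is proper: `(−∞,+∞]`-valued with at least one finite value. -/
def LbarProper (L : ℝ → EReal) : Prop :=
  (∀ t : ℝ, 0 ≤ t → L t ≠ ⊥) ∧ ∃ t : ℝ, 0 ≤ t ∧ L t ≠ ⊤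

/-- `μ([x, y])` for extended-real endpoints `x, y`, with `μ` regarded as a measure on
`[-∞, +∞]`. -/
def muIccE (μ : Measure ℝ) (x y : EReal) : ENNReal :=
  μ {z : ℝ | x ≤ (z : EReal) ∧ (z : EReal) ≤ y}

/-- `μ((x, y))` for extended-real endpoints `x, y`. -/
def muIooE (μ : Measure ℝ) (x y : EReal) : ENNReal :=
  μ {z : ℝ | x < (z : EReal) ∧ (z : EReal) < y}

open Classical in
/-- The Legendre transform extended to `[-∞,+∞]` by continuity, with the paper's
convention `L̄*(−∞) = −L̄(0⁺)`. -/
def LegendreExt (L : ℝ → EReal) (x : EReal) : EReal :=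
  if x = ⊥ then -(rightLimE L 0) else if x = ⊤ then ⊤ else LegendreEE L x

end


/-- Convexity of an `EReal`-valued function, expressed through finite upper bounds at the two
outer points (so that sums `⊤ + ⊥` never occur). -/
def ConvexE (L : ℝ → EReal) : Prop :=
  ∀ ⦃r s t p q : ℝ⦄, r < s → s < t → L r ≤ (p : EReal) → L t ≤ (q : EReal) →
    L s ≤ ((((t - s) * p + (s - r) * q) / (t - r) : ℝ) : EReal)

section ELog

theorem elog_le_coe_iff {c : ℝ} (hc : 0 < c) (m : ENNReal) (p : ℝ) :
    elog c m ≤ (p : EReal) ↔ m ≤ ENNReal.ofReal (Real.exp (p / c)) := by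
  unfold elog
  rw [mul_comm, ← EReal.le_div_iff_mul_le (by exact_mod_cast hc) (EReal.coe_ne_top c),
    ← EReal.coe_div, ← EReal.log_exp ((p / c : ℝ) : EReal), ENNReal.log_le_log_iff,
    EReal.exp_coe]

theorem elog_mono {c : ℝ} (hc : 0 < c) {m m' : ENNReal} (h : m ≤ m') : elog c m ≤ elog c m' :=
  mul_le_mul_of_nonneg_left (ENNReal.log_monotone h) (by exact_mod_cast hc.le)

variable {ι : Type*} {lf : Filter ι} {c : ι → ℝ}

theorem limsup_elog_le_of_eventually_le (hc : ∀ i, 0 < c i) {m : ι → ENNReal} {p : ℝ}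
    (h : ∀ᶠ i in lf, m i ≤ ENNReal.ofReal (Real.exp (p / c i))) :
    limsup (fun i => elog (c i) (m i)) lf ≤ (p : EReal) :=
  limsup_le_of_le (by isBoundedDefault) (h.mono fun i hi => (elog_le_coe_iff (hc i) _ _).2 hi)

theorem eventually_le_of_limsup_elog_lt (hc : ∀ i, 0 < c i) {m : ι → ENNReal} {p : ℝ}
    (h : limsup (fun i => elog (c i) (m i)) lf < (p : EReal)) :
    ∀ᶠ i in lf, m i ≤ ENNReal.ofReal (Real.exp (p / c i)) :=
  (eventually_lt_of_limsup_lt h (by isBoundedDefault)).mono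
    fun i hi => (elog_le_coe_iff (hc i) _ _).1 hi.le

end ELog

theorem EReal.le_of_forall_coe_lt {a b : EReal} (h : ∀ p : ℝ, b < (p : EReal) → a ≤ (p : EReal)) :
    a ≤ b := by
  by_contra! hlt
  obtain ⟨p, hbp, hpa⟩ := EReal.lt_iff_exists_real_btwn.1 hlt
  exact absurd (h p hbp) (not_le.2 hpa)

section LogMGF

variable {ι : Type*} {lf : Filter ι} {μ : ι → Measure ℝ} {c : ι → ℝ}

theorem genLogMGF_zero_le [∀ i, IsProbabilityMeasure (μ i)] (hc : ∀ i, 0 < c i) :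
    genLogMGF lf μ c 0 ≤ ((0 : ℝ) : EReal) :=
  limsup_elog_le_of_eventually_le hc (Eventually.of_forall fun i => by simp)

theorem convexE_genLogMGF (hc : ∀ i, 0 < c i) : ConvexE (genLogMGF lf μ c) := by
  have key : ∀ ⦃r s t p q : ℝ⦄, r < s → s < t → genLogMGF lf μ c r < (p : EReal) →
      genLogMGF lf μ c t < (q : EReal) →
      genLogMGF lf μ c s ≤ ((((t - s) * p + (s - r) * q) / (t - r) : ℝ) : EReal) := by
    intro r s t p q hrs hst hp hq
    have hrt : 0 < t - r := by linarith
    refine limsup_elog_le_of_eventually_le hc ?_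
    filter_upwards [eventually_le_of_limsup_elog_lt hc hp,
      eventually_le_of_limsup_elog_lt hc hq] with i hi hj
    have hci := hc i
    set θ := (t - s) / (t - r) with hθ
    set η := (s - r) / (t - r) with hη
    have hθ0 : 0 ≤ θ := div_nonneg (by linarith) hrt.le
    have hη0 : 0 ≤ η := div_nonneg (by linarith) hrt.le
    have hsum : θ + η = 1 := by rw [hθ, hη]; field_simp; ring
    have hcomb : s = θ * r + η * t := by rw [hθ, hη]; field_simp; ring
    have hrpow : ∀ u ξ : ℝ, 0 ≤ ξ →
        ENNReal.ofReal (Real.exp u) ^ ξ = ENNReal.ofReal (Real.exp (u * ξ)) := by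
      intro u ξ hξ
      rw [ENNReal.ofReal_rpow_of_nonneg (Real.exp_pos u).le hξ, ← Real.exp_mul]
    have hmul : ∀ u v : ℝ, ENNReal.ofReal (Real.exp u) * ENNReal.ofReal (Real.exp v)
        = ENNReal.ofReal (Real.exp (u + v)) := by
      intro u v
      rw [← ENNReal.ofReal_mul (Real.exp_pos u).le, ← Real.exp_add]
    have hmeas : ∀ u : ℝ, AEMeasurable
        (fun x : ℝ => ENNReal.ofReal (Real.exp (u * x / c i))) (μ i) := fun u =>
      (by fun_prop : Measurable fun x : ℝ => ENNReal.ofReal (Real.exp (u * x / c i))).aemeasurable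
    calc ∫⁻ x, ENNReal.ofReal (Real.exp (s * x / c i)) ∂(μ i)
        = ∫⁻ x, ENNReal.ofReal (Real.exp (r * x / c i)) ^ θ
            * ENNReal.ofReal (Real.exp (t * x / c i)) ^ η ∂(μ i) := by
          congr 1
          ext x
          rw [hrpow _ _ hθ0, hrpow _ _ hη0, hmul]
          congr 2
          rw [hcomb]
          ring
      _ ≤ (∫⁻ x, ENNReal.ofReal (Real.exp (r * x / c i)) ∂(μ i)) ^ θ
            * (∫⁻ x, ENNReal.ofReal (Real.exp (t * x / c i)) ∂(μ i)) ^ η :=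
          ENNReal.lintegral_mul_norm_pow_le (hmeas r) (hmeas t) hθ0 hη0 hsum
      _ ≤ ENNReal.ofReal (Real.exp (p / c i)) ^ θ * ENNReal.ofReal (Real.exp (q / c i)) ^ η := by
          gcongr
      _ = ENNReal.ofReal (Real.exp (((t - s) * p + (s - r) * q) / (t - r) / c i)) := by
          rw [hrpow _ _ hθ0, hrpow _ _ hη0, hmul]
          congr 2
          rw [hθ, hη]
          field_simp
  intro r s t p q hrs hst hp hq
  have hrt : 0 < t - r := by linarith
  refine EReal.le_of_forall_lt_iff_le.1 fun z hz => ?_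
  have hz' : ((t - s) * p + (s - r) * q) / (t - r) < z := by exact_mod_cast hz
  set ε := z - ((t - s) * p + (s - r) * q) / (t - r) with hε
  have hε0 : 0 < ε := by rw [hε]; linarith
  have h := key (p := p + ε) (q := q + ε) hrs hst
    (hp.trans_lt (by exact_mod_cast lt_add_of_pos_right p hε0))
    (hq.trans_lt (by exact_mod_cast lt_add_of_pos_right q hε0))
  have heq : ((t - s) * (p + ε) + (s - r) * (q + ε)) / (t - r) = z := by
    have : ((t - s) * (p + ε) + (s - r) * (q + ε)) / (t - r)
        = ((t - s) * p + (s - r) * q) / (t - r) + ε := by field_simp; ring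
    rw [this, hε]; ring
  rwa [heq] at h

/-- The exponential Chebyshev bound for intervals whose left endpoints converge. -/
theorem limsup_muIccE_le (hc : ∀ i, 0 < c i) {t : ℝ} (ht : 0 < t) {a : ℝ}
    {x : ι → EReal} (hx : Tendsto x lf (𝓝 (a : EReal))) (y : ι → EReal) :
    limsup (fun i => elog (c i) (muIccE (μ i) (x i) (y i))) lf
      ≤ genLogMGF lf μ c t - (t : EReal) * (a : EReal) := by
  have key : ∀ p : ℝ, genLogMGF lf μ c t < (p : EReal) → ∀ a' : ℝ, a' < a →
      limsup (fun i => elog (c i) (muIccE (μ i) (x i) (y i))) lf ≤ ((p - t * a' : ℝ) : EReal) := by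
    intro p hp a' ha'
    refine limsup_elog_le_of_eventually_le hc ?_
    filter_upwards [eventually_le_of_limsup_elog_lt hc hp,
      hx.eventually (lt_mem_nhds (by exact_mod_cast ha' : (a' : EReal) < a))] with i hi hxi
    have hci := hc i
    have hpt : ∀ z : ℝ, z ∈ {z : ℝ | x i ≤ (z : EReal) ∧ (z : EReal) ≤ y i} →
        ENNReal.ofReal (Real.exp (t * a' / c i)) ≤ ENNReal.ofReal (Real.exp (t * z / c i)) := by
      intro z hz
      have : a' < z := by exact_mod_cast hxi.trans_le hz.1
      gcongr
    have hE : 0 < Real.exp (t * a' / c i) := Real.exp_pos _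
    have h1 : ENNReal.ofReal (Real.exp (t * a' / c i)) * muIccE (μ i) (x i) (y i)
        ≤ ENNReal.ofReal (Real.exp (p / c i)) :=
      calc _ ≤ ENNReal.ofReal (Real.exp (t * a' / c i)) * μ i {z : ℝ |
            ENNReal.ofReal (Real.exp (t * a' / c i)) ≤ ENNReal.ofReal (Real.exp (t * z / c i))} :=
            mul_le_mul_right (measure_mono hpt) _
        _ ≤ ∫⁻ z, ENNReal.ofReal (Real.exp (t * z / c i)) ∂(μ i) :=
            mul_meas_ge_le_lintegral (by fun_prop) _
        _ ≤ _ := hi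
    have h2 : (p - t * a') / c i = p / c i - t * a' / c i := by ring
    rw [h2, Real.exp_sub, ENNReal.ofReal_div_of_pos hE]
    rw [ENNReal.le_div_iff_mul_le (Or.inl (by simpa using hE)) (Or.inl ENNReal.ofReal_ne_top),
      mul_comm]
    exact h1
  rw [← EReal.coe_mul]
  refine EReal.le_of_forall_coe_lt fun z hz => ?_
  have hz' : genLogMGF lf μ c t < ((z + t * a : ℝ) : EReal) := by
    rw [EReal.coe_add]
    exact (EReal.sub_lt_iff (Or.inl (EReal.coe_ne_bot _)) (Or.inl (EReal.coe_ne_top _))).1 hz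
  obtain ⟨p, hp, hpz⟩ := EReal.lt_iff_exists_real_btwn.1 hz'
  have hpz' : p < z + t * a := by exact_mod_cast hpz
  refine (key p hp (a - (z + t * a - p) / t) (by
    have := div_pos (sub_pos.2 hpz') ht
    linarith)).trans ?_
  have : p - t * (a - (z + t * a - p) / t) = z := by field_simp; ring
  rw [this]

/-- Exponential tilting: if the parts of the moment generating function at `t` coming from the
left of `a`, from the right of `b`, and from the interval `(x, y)` have exponential rate at most
`k`, so does the whole. -/
theorem genLogMGF_le_of_tilting (hc : ∀ i, 0 < c i) (hc0 : Tendsto c lf (𝓝 0))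
    {s t s' a b p q m k : ℝ} (ht : 0 ≤ t) (hst : s < t) (hts' : t < s')
    (hp : genLogMGF lf μ c s < (p : EReal)) (hq : genLogMGF lf μ c s' < (q : EReal))
    {x y : ι → EReal} (hx : ∀ᶠ i in lf, x i ≤ (a : EReal)) (hy : ∀ᶠ i in lf, (b : EReal) ≤ y i)
    (hm : limsup (fun i => elog (c i) (muIooE (μ i) (x i) (y i))) lf < (m : EReal))
    (h1 : p + (t - s) * a ≤ k) (h2 : q - (s' - t) * b ≤ k) (h3 : m + t * b ≤ k) :
    genLogMGF lf μ c t ≤ (k : EReal) := by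
  refine EReal.le_of_forall_lt_iff_le.1 fun k' hk' => ?_
  have hkk' : k < k' := by exact_mod_cast hk'
  have hlog : ∀ᶠ i in lf, c i * Real.log 3 < k' - k := by
    have : Tendsto (fun i => c i * Real.log 3) lf (𝓝 0) := by
      simpa using hc0.mul_const (Real.log 3)
    exact this.eventually (gt_mem_nhds (by linarith))
  refine limsup_elog_le_of_eventually_le hc ?_
  filter_upwards [hlog, eventually_le_of_limsup_elog_lt hc hp,
    eventually_le_of_limsup_elog_lt hc hq, eventually_le_of_limsup_elog_lt hc hm, hx, hy]
    with i hli hpi hqi hmi hxi hyi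
  have hci := hc i
  have hmul : ∀ u v : ℝ, ENNReal.ofReal (Real.exp u) * ENNReal.ofReal (Real.exp v)
      = ENNReal.ofReal (Real.exp (u + v)) := by
    intro u v
    rw [← ENNReal.ofReal_mul (Real.exp_pos u).le, ← Real.exp_add]
  set S : Set ℝ := {z : ℝ | x i < (z : EReal) ∧ (z : EReal) < y i} with hS
  have hSm : MeasurableSet S :=
    (measurableSet_lt measurable_const measurable_coe_real_ereal).inter
      (measurableSet_lt measurable_coe_real_ereal measurable_const)
  have hpt : ∀ z : ℝ, ENNReal.ofReal (Real.exp (t * z / c i)) ≤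
      ENNReal.ofReal (Real.exp ((t - s) * a / c i)) * ENNReal.ofReal (Real.exp (s * z / c i))
      + ENNReal.ofReal (Real.exp (-((s' - t) * b) / c i))
        * ENNReal.ofReal (Real.exp (s' * z / c i))
      + ENNReal.ofReal (Real.exp (t * b / c i)) * S.indicator 1 z := by
    intro z
    rcases le_or_gt b z with hbz | hzb
    · refine le_add_right (le_add_left ?_)
      rw [hmul, ← add_div]
      gcongr
      nlinarith
    · by_cases hxz : x i < (z : EReal)
      · have hzS : z ∈ S :=
          ⟨hxz, lt_of_lt_of_le (by exact_mod_cast hzb) hyi⟩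
        refine le_add_left ?_
        rw [indicator_of_mem hzS, Pi.one_apply, mul_one]
        gcongr
      · have hza : z ≤ a := by exact_mod_cast (not_lt.1 hxz).trans hxi
        refine le_add_right (le_add_right ?_)
        rw [hmul, ← add_div]
        gcongr
        nlinarith
  have hmono : ∀ u v : ℝ, u ≤ v → ENNReal.ofReal (Real.exp (u / c i))
      ≤ ENNReal.ofReal (Real.exp (v / c i)) := fun u v huv => by gcongr
  calc ∫⁻ z, ENNReal.ofReal (Real.exp (t * z / c i)) ∂(μ i)
      ≤ ∫⁻ z, (ENNReal.ofReal (Real.exp ((t - s) * a / c i))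
          * ENNReal.ofReal (Real.exp (s * z / c i))
        + ENNReal.ofReal (Real.exp (-((s' - t) * b) / c i))
          * ENNReal.ofReal (Real.exp (s' * z / c i))
        + ENNReal.ofReal (Real.exp (t * b / c i)) * S.indicator 1 z) ∂(μ i) :=
        lintegral_mono hpt
    _ = ENNReal.ofReal (Real.exp ((t - s) * a / c i))
          * ∫⁻ z, ENNReal.ofReal (Real.exp (s * z / c i)) ∂(μ i)
        + ENNReal.ofReal (Real.exp (-((s' - t) * b) / c i))
          * ∫⁻ z, ENNReal.ofReal (Real.exp (s' * z / c i)) ∂(μ i)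
        + ENNReal.ofReal (Real.exp (t * b / c i)) * μ i S := by
        rw [lintegral_add_left (by fun_prop), lintegral_add_left (by fun_prop),
          lintegral_const_mul _ (by fun_prop), lintegral_const_mul _ (by fun_prop),
          lintegral_const_mul _ (measurable_one.indicator hSm), lintegral_indicator_one hSm]
    _ ≤ ENNReal.ofReal (Real.exp ((t - s) * a / c i)) * ENNReal.ofReal (Real.exp (p / c i))
        + ENNReal.ofReal (Real.exp (-((s' - t) * b) / c i)) * ENNReal.ofReal (Real.exp (q / c i))
        + ENNReal.ofReal (Real.exp (t * b / c i)) * ENNReal.ofReal (Real.exp (m / c i)) := by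
        gcongr
        exact hmi
    _ ≤ ENNReal.ofReal (Real.exp (k / c i)) + ENNReal.ofReal (Real.exp (k / c i))
        + ENNReal.ofReal (Real.exp (k / c i)) := by
        rw [hmul, hmul, hmul, ← add_div, ← add_div, ← add_div]
        exact add_le_add (add_le_add (hmono _ _ (by linarith)) (hmono _ _ (by linarith)))
          (hmono _ _ (by linarith))
    _ = ENNReal.ofReal (Real.exp ((k + c i * Real.log 3) / c i)) := by
        rw [← ENNReal.ofReal_add (by positivity) (by positivity),
          ← ENNReal.ofReal_add (by positivity) (by positivity), add_div,
          mul_div_cancel_left₀ _ hci.ne', Real.exp_add, Real.exp_log (by norm_num)]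
        congr 1
        ring
    _ ≤ ENNReal.ofReal (Real.exp (k' / c i)) := hmono _ _ (by linarith)

end LogMGF

section RightDeriv

variable {L : ℝ → EReal}

theorem coe_sub_mul_inv (m l d : ℝ) :
    ((m : EReal) - (l : EReal)) * ((d⁻¹ : ℝ) : EReal) = (((m - l) / d : ℝ) : EReal) := by
  rw [← EReal.coe_sub, ← EReal.coe_mul, div_eq_mul_inv]

theorem exists_lt_of_rightDerivE_lt {t l B : ℝ} (hbot : ∀ s, t < s → L s ≠ ⊥)
    (hl : L t = (l : EReal)) (h : rightDerivE L t < (B : EReal)) :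
    ∃ s m : ℝ, t < s ∧ L s = (m : EReal) ∧ m - l < B * (s - t) := by
  unfold rightDerivE at h
  split_ifs at h with htop hex
  · exact absurd h not_top_lt
  · obtain ⟨s, hs, hs'⟩ := hex
    exact absurd hs' (hbot s hs)
  · simp only [iInf_lt_iff] at h
    obtain ⟨s, hs, hlt⟩ := h
    have hts : 0 < s - t := sub_pos.2 hs
    induction hm : L s with
    | bot => exact absurd hm (hbot s hs)
    | top =>
      rw [hm, hl, EReal.top_sub_coe, EReal.top_mul_coe_of_pos (inv_pos.2 hts)] at hlt
      exact absurd hlt not_top_lt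
    | coe m =>
      rw [hm, hl, coe_sub_mul_inv] at hlt
      exact ⟨s, m, hs, hm, (div_lt_iff₀ hts).1 (by exact_mod_cast hlt)⟩

theorem rightDerivE_le {s t l m : ℝ} (hbot : ∀ s, t < s → L s ≠ ⊥)
    (hl : L t = (l : EReal)) (hs : t < s) (hm : L s = (m : EReal)) :
    rightDerivE L t ≤ (((m - l) / (s - t) : ℝ) : EReal) := by
  unfold rightDerivE
  rw [if_neg (fun h => by simpa [hm] using h s hs),
    if_neg (by rintro ⟨s, hs, hs'⟩; exact hbot s hs hs')]
  refine (iInf₂_le s hs).trans ?_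
  rw [hm, hl, coe_sub_mul_inv]

theorem exists_coe_of_le_coe {v : EReal} (hbot : v ≠ ⊥) {p : ℝ} (h : v ≤ (p : EReal)) :
    ∃ l : ℝ, v = (l : EReal) :=
  ⟨v.toReal, (EReal.coe_toReal (h.trans_lt (EReal.coe_lt_top p)).ne hbot).symm⟩

theorem ConvexE.exists_coe_of_lt (hL : ConvexE L) (h0 : L 0 ≤ ((0 : ℝ) : EReal)) {t s q : ℝ}
    (ht : 0 < t) (hts : t < s) (hbot : L t ≠ ⊥) (hq : L s ≤ (q : EReal)) :
    ∃ l : ℝ, L t = (l : EReal) :=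
  exists_coe_of_le_coe hbot (hL ht hts h0 hq)

theorem ConvexE.exists_coe_of_rightDerivE_lt_top (hL : ConvexE L)
    (h0 : L 0 ≤ ((0 : ℝ) : EReal)) {t : ℝ} (ht : 0 < t) (hbot : L t ≠ ⊥)
    (h : rightDerivE L t < ⊤) : ∃ l : ℝ, L t = (l : EReal) := by
  have hs : ∃ s, t < s ∧ L s ≠ ⊤ := by
    by_contra! hall
    rw [rightDerivE, if_pos hall] at h
    exact lt_irrefl _ h
  obtain ⟨s, hts, hs⟩ := hs
  exact hL.exists_coe_of_lt h0 ht hts hbot (EReal.le_coe_toReal hs)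

theorem ConvexE.rightDerivE_le_rightDerivE (hL : ConvexE L) (h0 : L 0 ≤ ((0 : ℝ) : EReal))
    {s t : ℝ} (hs : 0 < s) (hst : s < t) (hbot : ∀ r, s ≤ r → L r ≠ ⊥) :
    rightDerivE L s ≤ rightDerivE L t := by
  refine EReal.le_of_forall_coe_lt fun B hB => ?_
  obtain ⟨l, hl⟩ := hL.exists_coe_of_rightDerivE_lt_top h0 (hs.trans hst) (hbot t hst.le)
    (hB.trans (EReal.coe_lt_top B))
  obtain ⟨r, m, htr, hm, hlt⟩ :=
    exists_lt_of_rightDerivE_lt (fun r hr => hbot r (hst.trans hr).le) hl hB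
  obtain ⟨n, hn⟩ := hL.exists_coe_of_lt h0 hs hst (hbot s le_rfl) hl.le
  refine (rightDerivE_le (fun r hr => hbot r hr.le) hn hst hl).trans ?_
  have hc := hL hst htr hn.le hm.le
  rw [hl, EReal.coe_le_coe_iff, le_div_iff₀ (by linarith)] at hc
  rw [EReal.coe_le_coe_iff, div_le_iff₀ (by linarith)]
  have : (l - n) * (r - t) ≤ (B * (t - s)) * (r - t) := by
    nlinarith [mul_lt_mul_of_pos_left hlt (sub_pos.2 hst)]
  exact le_of_mul_le_mul_right this (by linarith)

variable {lam : ℝ}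

theorem ne_bot_of_rightLimE_rightDerivE_ne_bot (hne : rightLimE (rightDerivE L) lam ≠ ⊥) {s : ℝ}
    (hs : lam < s) : L s ≠ ⊥ := by
  intro hbot
  refine hne (le_bot_iff.1 (limsup_le_of_le (by isBoundedDefault) ?_))
  filter_upwards [Ioo_mem_nhdsGT hs] with t ht
  rw [rightDerivE, if_neg (fun h => by simpa [hbot] using h s ht.2), if_pos ⟨s, ht.2, hbot⟩]

theorem ConvexE.rightLimE_rightDerivE_le (hL : ConvexE L) (h0 : L 0 ≤ ((0 : ℝ) : EReal))
    (hlam : 0 ≤ lam) (hbot : ∀ s, lam < s → L s ≠ ⊥) {t : ℝ} (ht : lam < t) :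
    rightLimE (rightDerivE L) lam ≤ rightDerivE L t := by
  refine limsup_le_of_le (by isBoundedDefault) ?_
  filter_upwards [Ioo_mem_nhdsGT ht] with s hs
  exact hL.rightDerivE_le_rightDerivE h0 (hlam.trans_lt hs.1) hs.2
    fun r hr => hbot r (hs.1.trans_le hr)

/-- The line of slope `a = L'_r(λ⁺)` through `(λ, L(λ⁺))` lies below the graph of `L`. -/
theorem ConvexE.rightLimE_le_add (hL : ConvexE L) (h0 : L 0 ≤ ((0 : ℝ) : EReal))
    (hlam : 0 ≤ lam) (hbot : ∀ s, lam < s → L s ≠ ⊥) {a : ℝ}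
    (ha : rightLimE (rightDerivE L) lam = (a : EReal)) {t p : ℝ} (hp : L t ≤ (p : EReal)) :
    rightLimE L lam ≤ ((p + (lam - t) * a : ℝ) : EReal) := by
  refine EReal.le_of_forall_lt_iff_le.1 fun z hz => ?_
  have hz' : p + (lam - t) * a < z := by exact_mod_cast hz
  set δ := z - (p + (lam - t) * a) with hδ
  have hδ0 : 0 < δ := by rw [hδ]; linarith
  set ε := δ / (2 * (|lam - t| + 1)) with hε
  have habs : 0 < |lam - t| + 1 := by positivity
  have hε0 : 0 < ε := by positivity
  have hεδ : ε * (|lam - t| + 1) = δ / 2 := by rw [hε]; field_simp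
  have hD : ∀ᶠ s in 𝓝[>] lam, rightDerivE L s < ((a + ε : ℝ) : EReal) := by
    refine eventually_lt_of_limsup_lt ?_ (by isBoundedDefault)
    change rightLimE (rightDerivE L) lam < _
    rw [ha]
    exact_mod_cast lt_add_of_pos_right a hε0
  have hsmall : ∀ᶠ s in 𝓝[>] lam, (s - lam) * a < δ / 2 := by
    have : Tendsto (fun s : ℝ => (s - lam) * a) (𝓝 lam) (𝓝 ((lam - lam) * a)) :=
      ((continuous_id.sub continuous_const).mul continuous_const).tendsto lam
    rw [sub_self, zero_mul] at this
    exact (this.mono_left nhdsWithin_le_nhds).eventually (gt_mem_nhds (by positivity))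
  refine limsup_le_of_le (by isBoundedDefault) ?_
  rcases lt_or_ge lam t with hlt | hle
  · obtain ⟨m, hm⟩ := exists_coe_of_le_coe (hbot t hlt) hp
    filter_upwards [hsmall, Ioo_mem_nhdsGT hlt] with s hs hst
    obtain ⟨l, hl⟩ := hL.exists_coe_of_lt h0 (hlam.trans_lt hst.1) hst.2 (hbot s hst.1) hp
    have h1 : (a : EReal) ≤ (((m - l) / (t - s) : ℝ) : EReal) := by
      rw [← ha]
      exact (hL.rightLimE_rightDerivE_le h0 hlam hbot hst.1).trans
        (rightDerivE_le (fun r hr => hbot r (hst.1.trans hr)) hl hst.2 hm)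
    rw [EReal.coe_le_coe_iff, le_div_iff₀ (sub_pos.2 hst.2)] at h1
    rw [hm, EReal.coe_le_coe_iff] at hp
    rw [hl, EReal.coe_le_coe_iff]
    nlinarith
  · filter_upwards [hsmall, hD, Ioo_mem_nhdsGT (lt_add_one lam)] with s hs hDs hs1
    obtain ⟨l, hl⟩ := hL.exists_coe_of_rightDerivE_lt_top h0 (hlam.trans_lt hs1.1)
      (hbot s hs1.1) (hDs.trans (EReal.coe_lt_top _))
    obtain ⟨r, m, hsr, hm, hlt⟩ :=
      exists_lt_of_rightDerivE_lt (fun r hr => hbot r (hs1.1.trans hr)) hl hDs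
    have hts : t < s := hle.trans_lt hs1.1
    have hc := hL hts hsr hp hm.le
    rw [hl, EReal.coe_le_coe_iff, le_div_iff₀ (by linarith)] at hc
    rw [hl, EReal.coe_le_coe_iff]
    have h1 : (l - p) * (r - s) ≤ ((a + ε) * (s - t)) * (r - s) := by
      nlinarith [mul_lt_mul_of_pos_left hlt (sub_pos.2 hts)]
    have h2 : l - p ≤ (a + ε) * (s - t) := le_of_mul_le_mul_right h1 (by linarith)
    rw [abs_of_nonneg (sub_nonneg.2 hle)] at hεδ
    have h3 : ε * (s - t) ≤ δ / 2 := by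
      rw [← hεδ]
      exact mul_le_mul_of_nonneg_left (by linarith [hs1.2]) hε0.le
    nlinarith

theorem ConvexE.rightLimE_sub_le (hL : ConvexE L) (h0 : L 0 ≤ ((0 : ℝ) : EReal))
    (hlam : 0 ≤ lam) (hbot : ∀ s, lam < s → L s ≠ ⊥) {a : ℝ}
    (ha : rightLimE (rightDerivE L) lam = (a : EReal)) (t : ℝ) :
    rightLimE L lam - (lam : EReal) * (a : EReal) ≤ L t - (t : EReal) * (a : EReal) := by
  rw [← EReal.coe_mul, ← EReal.coe_mul]
  refine EReal.le_of_forall_coe_lt fun z hz => ?_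
  rw [EReal.sub_lt_iff (Or.inl (EReal.coe_ne_bot _)) (Or.inl (EReal.coe_ne_top _)),
    ← EReal.coe_add] at hz
  rw [EReal.sub_le_iff_le_add (Or.inl (EReal.coe_ne_bot _)) (Or.inl (EReal.coe_ne_top _)),
    ← EReal.coe_add]
  refine (hL.rightLimE_le_add h0 hlam hbot ha hz.le).trans_eq ?_
  congr 1
  ring

theorem iInf_sub_le_rightLimE_sub (hlam : 0 ≤ lam) (a : ℝ) :
    ⨅ t ∈ Ioi (0 : ℝ), (L t - (t : EReal) * (a : EReal))
      ≤ rightLimE L lam - (lam : EReal) * (a : EReal) := by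
  refine EReal.le_of_forall_coe_lt fun z hz => ?_
  rw [← EReal.coe_mul, EReal.sub_lt_iff (Or.inl (EReal.coe_ne_bot _))
    (Or.inl (EReal.coe_ne_top _)), ← EReal.coe_add] at hz
  obtain ⟨w, hw, hwz⟩ := EReal.lt_iff_exists_real_btwn.1 hz
  have hwz' : w < z + lam * a := by exact_mod_cast hwz
  have h1 : ∀ᶠ t in 𝓝[>] lam, L t < (w : EReal) :=
    eventually_lt_of_limsup_lt hw (by isBoundedDefault)
  have h2 : ∀ᶠ t in 𝓝[>] lam, w < z + t * a := by
    have : Tendsto (fun t : ℝ => z + t * a) (𝓝 lam) (𝓝 (z + lam * a)) :=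
      (continuous_const.add (continuous_id.mul continuous_const)).tendsto lam
    exact (this.mono_left nhdsWithin_le_nhds).eventually (lt_mem_nhds hwz')
  obtain ⟨t, ⟨hLt, hwt⟩, ht⟩ := ((h1.and h2).and self_mem_nhdsWithin).exists
  refine (iInf₂_le t (hlam.trans_lt ht)).trans ?_
  rw [← EReal.coe_mul, EReal.sub_le_iff_le_add (Or.inl (EReal.coe_ne_bot _))
    (Or.inl (EReal.coe_ne_top _)), ← EReal.coe_add]
  exact hLt.le.trans (by exact_mod_cast hwt.le)

theorem neg_LegendreEE_coe (L : ℝ → EReal) (a : ℝ) :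
    -LegendreEE L (a : EReal) = ⨅ t : ℝ, (L t - (t : EReal) * (a : EReal)) := by
  have hneg : ∀ t : ℝ, -((t : EReal) * (a : EReal) - L t) = L t - (t : EReal) * (a : EReal) := by
    intro t
    rw [← EReal.coe_mul, EReal.neg_sub (Or.inl (EReal.coe_ne_bot _))
      (Or.inl (EReal.coe_ne_top _)), add_comm, ← sub_eq_add_neg]
  refine le_antisymm (le_iInf fun t => ?_) (EReal.le_neg_of_le_neg (iSup_le fun t => ?_))
  · rw [← hneg]
    exact EReal.neg_le_neg_iff.2 (le_iSup (fun t : ℝ => (t : EReal) * (a : EReal) - L t) t)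
  · refine EReal.le_neg_of_le_neg ?_
    rw [hneg]
    exact iInf_le _ t

end RightDeriv

/-- The lower bound: the tilted measures at points `t` slightly to the right of the `u n`
concentrate on `(x, y)`. -/
theorem rightLimE_sub_le_limsup_muIooE
    {ι : Type*} {lf : Filter ι} {μ : ι → Measure ℝ} [∀ i, IsProbabilityMeasure (μ i)]
    {c : ι → ℝ} (hc : ∀ i, 0 < c i) (hc0 : Tendsto c lf (𝓝 0))
    {lam : ℝ} (hlam : 0 ≤ lam) {a : ℝ}
    (hbot : ∀ s, lam < s → genLogMGF lf μ c s ≠ ⊥)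
    (ha : rightLimE (rightDerivE (genLogMGF lf μ c)) lam = (a : EReal))
    {u : ℕ → ℝ} (hu : ∀ n, lam < u n)
    (hau : ∀ n, (a : EReal) < rightDerivE (genLogMGF lf μ c) (u n))
    (hlim : Tendsto (fun n => rightDerivE (genLogMGF lf μ c) (u n)) atTop (𝓝 (a : EReal)))
    {x y : ι → EReal} (hx : Tendsto x lf (𝓝 (a : EReal))) (hy : (a : EReal) < liminf y lf) :
    rightLimE (genLogMGF lf μ c) lam - (lam : EReal) * (a : EReal)
      ≤ limsup (fun i => elog (c i) (muIooE (μ i) (x i) (y i))) lf := by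
  set L := genLogMGF lf μ c with hLdef
  have hL : ConvexE L := convexE_genLogMGF hc
  have h0 : L 0 ≤ ((0 : ℝ) : EReal) := genLogMGF_zero_le hc
  by_contra! hcon
  obtain ⟨m, hMm, hmΛ⟩ := EReal.lt_iff_exists_real_btwn.1 hcon
  obtain ⟨z, hmz, hzΛ⟩ := EReal.lt_iff_exists_real_btwn.1 hmΛ
  have hmz' : m < z := by exact_mod_cast hmz
  have hu0 : 0 < u 0 := hlam.trans_lt (hu 0)
  obtain ⟨b, hab, hb⟩ := EReal.lt_iff_exists_real_btwn.1
    (lt_min hy (show (a : EReal) < ((a + (z - m) / u 0 : ℝ) : EReal) by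
      exact_mod_cast lt_add_of_pos_right a (div_pos (sub_pos.2 hmz') hu0)))
  have hab' : a < b := by exact_mod_cast hab
  have hbu : (b - a) * u 0 < z - m := by
    have : b < a + (z - m) / u 0 := by exact_mod_cast hb.trans_le (min_le_right _ _)
    rw [← lt_div_iff₀ hu0]
    linarith
  have hby : ∀ᶠ i in lf, (b : EReal) ≤ y i :=
    (eventually_lt_of_lt_liminf (hb.trans_le (min_le_left _ _)) (by isBoundedDefault)).mono
      fun i hi => hi.le
  obtain ⟨n, hn0, hnb⟩ := ((hlim.eventually (gt_mem_nhds (hau 0))).and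
    (hlim.eventually (gt_mem_nhds hab))).exists
  have hbot' : ∀ r, u n ≤ r → L r ≠ ⊥ := fun r hr => hbot r ((hu n).trans_le hr)
  have hun : 0 < u n := hlam.trans_lt (hu n)
  have hun0 : u n < u 0 := by
    by_contra! hle
    rcases hle.eq_or_lt with heq | hlt
    · rw [heq] at hn0
      exact lt_irrefl _ hn0
    · exact absurd hn0 (not_lt.2 (hL.rightDerivE_le_rightDerivE h0 hu0 hlt
        fun r hr => hbot r ((hu 0).trans_le hr)))
  obtain ⟨l, hl⟩ := hL.exists_coe_of_rightDerivE_lt_top h0 hun (hbot' _ le_rfl)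
    (hnb.trans (EReal.coe_lt_top b))
  obtain ⟨s', q, hs', hq, hqlt⟩ :=
    exists_lt_of_rightDerivE_lt (fun r hr => hbot' r hr.le) hl hnb
  have hev : ∀ᶠ t in 𝓝[>] (u n), q - l - a * (t - u n) < b * (s' - t) := by
    have h1 : Tendsto (fun t : ℝ => q - l - a * (t - u n)) (𝓝[>] (u n))
        (𝓝 (q - l - a * (u n - u n))) :=
      ((by fun_prop : Continuous fun t : ℝ => q - l - a * (t - u n)).tendsto _).mono_left
        nhdsWithin_le_nhds
    have h2 : Tendsto (fun t : ℝ => b * (s' - t)) (𝓝[>] (u n)) (𝓝 (b * (s' - u n))) :=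
      ((by fun_prop : Continuous fun t : ℝ => b * (s' - t)).tendsto _).mono_left
        nhdsWithin_le_nhds
    exact h1.eventually_lt h2 (by linarith)
  obtain ⟨t, ⟨htlt, hts'⟩, ht0⟩ :=
    ((hev.and (Ioo_mem_nhdsGT hs')).and (Ioo_mem_nhdsGT hun0)).exists
  have hut : u n < t := hts'.1
  obtain ⟨v, hv⟩ := hL.exists_coe_of_lt h0 (hun.trans hut) hts'.2 (hbot' t hut.le) hq.le
  have hslope : a < (v - l) / (t - u n) := by
    exact_mod_cast (hau n).trans_le (rightDerivE_le (fun r hr => hbot' r hr.le) hl hut hv)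
  obtain ⟨a', haa', ha'⟩ := exists_between hslope
  rw [lt_div_iff₀ (sub_pos.2 hut)] at hslope ha'
  have hxa : ∀ᶠ i in lf, x i ≤ (a' : EReal) :=
    (hx.eventually (gt_mem_nhds (by exact_mod_cast haa' : (a : EReal) < a'))).mono
      fun i hi => hi.le
  have hzv : z < v - t * a := by
    have := hzΛ.trans_le (hL.rightLimE_sub_le h0 hlam hbot ha t)
    rw [hv] at this
    exact_mod_cast this
  have hmv : m + t * b < v := by
    have : (b - a) * t ≤ (b - a) * u 0 :=
      mul_le_mul_of_nonneg_left ht0.2.le (sub_nonneg.2 hab'.le)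
    nlinarith
  have hl' : l + (t - u n) * a' < v := by nlinarith
  have hq' : q - (s' - t) * b < v := by nlinarith
  obtain ⟨k, hk, hkv⟩ := exists_between (max_lt (max_lt hl' hq') hmv)
  simp only [max_lt_iff] at hk
  obtain ⟨⟨hk1, hk2⟩, hk3⟩ := hk
  have hfinal := genLogMGF_le_of_tilting (μ := μ) hc hc0 (hun.trans hut).le hut hts'.2
    (p := k - (t - u n) * a') (q := k + (s' - t) * b) (m := m) (k := k)
    (by rw [← hLdef, hl]; exact_mod_cast (by linarith))
    (by rw [← hLdef, hq]; exact_mod_cast (by linarith))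
    hxa hby hMm (by linarith) (by linarith) (by linarith)
  rw [← hLdef, hv, EReal.coe_le_coe_iff] at hfinal
  linarith

theorem statement0
    {ι : Type*} (lf : Filter ι) [lf.NeBot]
    (μ : ι → Measure ℝ) [∀ i, IsProbabilityMeasure (μ i)]
    (c : ι → ℝ) (hc : ∀ i, 0 < c i) (hc0 : Filter.Tendsto c lf (nhds (0 : ℝ)))
    (L : ℝ → EReal) (hL : L = genLogMGF lf μ c)
    (lam : ℝ) (hlam : 0 ≤ lam)
    (hne : rightLimE (rightDerivE L) lam ≠ ⊥)
    (hacc : ∃ u : ℕ → ℝ, (∀ n, lam < u n) ∧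
      (∀ n, rightLimE (rightDerivE L) lam < rightDerivE L (u n)) ∧
      Filter.Tendsto (fun n => rightDerivE L (u n)) Filter.atTop (nhds (rightLimE (rightDerivE L) lam)))
    (x y : ι → EReal)
    (hx : Filter.Tendsto x lf (nhds (rightLimE (rightDerivE L) lam)))
    (hy : rightLimE (rightDerivE L) lam < Filter.liminf y lf) :
    Filter.limsup (fun i => elog (c i) (muIccE (μ i) (x i) (y i))) lf
        = rightLimE L lam - (lam : EReal) * rightLimE (rightDerivE L) lam ∧
    Filter.limsup (fun i => elog (c i) (muIooE (μ i) (x i) (y i))) lf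
        = rightLimE L lam - (lam : EReal) * rightLimE (rightDerivE L) lam ∧
    rightLimE L lam - (lam : EReal) * rightLimE (rightDerivE L) lam = - LegendreEE L (rightLimE (rightDerivE L) lam) ∧
    - LegendreEE L (rightLimE (rightDerivE L) lam) = ⨅ t ∈ Set.Ioi (0:ℝ), (L t - (t : EReal) * rightLimE (rightDerivE L) lam) := by
  obtain ⟨u, hu, hau, hlim⟩ := hacc
  have hbot : ∀ s, lam < s → L s ≠ ⊥ := fun s hs =>
    ne_bot_of_rightLimE_rightDerivE_ne_bot hne hs
  obtain ⟨a, ha⟩ : ∃ a : ℝ, rightLimE (rightDerivE L) lam = (a : EReal) :=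
    ⟨_, (EReal.coe_toReal ((hau 0).trans_le le_top).ne hne).symm⟩
  rw [ha] at hau hlim hx hy ⊢
  subst hL
  have hconv : ConvexE (genLogMGF lf μ c) := convexE_genLogMGF hc
  have h0 : genLogMGF lf μ c 0 ≤ ((0 : ℝ) : EReal) := genLogMGF_zero_le hc
  have hle := hconv.rightLimE_sub_le h0 hlam hbot ha
  have hinf := iInf_sub_le_rightLimE_sub (L := genLogMGF lf μ c) hlam a
  have hlower := rightLimE_sub_le_limsup_muIooE hc hc0 hlam hbot ha hu hau hlim hx hy
  have hmono : limsup (fun i => elog (c i) (muIooE (μ i) (x i) (y i))) lf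
      ≤ limsup (fun i => elog (c i) (muIccE (μ i) (x i) (y i))) lf :=
    limsup_le_limsup (Eventually.of_forall fun i => elog_mono (hc i)
      (measure_mono fun z hz => ⟨hz.1.le, hz.2.le⟩))
  have hupper : limsup (fun i => elog (c i) (muIccE (μ i) (x i) (y i))) lf
      ≤ rightLimE (genLogMGF lf μ c) lam - (lam : EReal) * (a : EReal) :=
    (le_iInf₂ fun t ht => limsup_muIccE_le hc ht hx y).trans hinf
  have hall : ⨅ t : ℝ, (genLogMGF lf μ c t - (t : EReal) * (a : EReal))
      ≤ ⨅ t ∈ Ioi (0 : ℝ), (genLogMGF lf μ c t - (t : EReal) * (a : EReal)) :=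
    le_iInf₂ fun t _ => iInf_le _ t
  rw [neg_LegendreEE_coe]
  exact ⟨hupper.antisymm (hlower.trans hmono), (hmono.trans hupper).antisymm hlower,
    (le_iInf hle).antisymm (hall.trans hinf), hall.antisymm (hinf.trans (le_iInf hle))⟩
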